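/- arXiv:2412.20434 — 2 statements merged into one kernel-verified Lean document; each statement's English description precedes it below -/
import Mathlib

section
/- For every real r with |r| < 1 and every t ∈ [−1, 1], the series Σ_{k=0}^∞ r^k · P_k(t) converges absolutely and its sum equals (1 − 2·r·t + r²)^{−1/2}. -/
open scoped BigOperators

/-- The Legendre polynomials, defined by the three-term recurrence
`P₀ = 1`, `P₁ t = t`, `k·P_k t = (2k−1)·t·P_{k−1} t − (k−1)·P_{k−2} t`. -/
noncomputable def legendre : ℕ → ℝ → ℝ
  | 0, _ => 1
  | 1, t => t
  | (n + 2), t =>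
      ((2 * (n : ℝ) + 3) * t * legendre (n + 1) t - ((n : ℝ) + 1) * legendre n t) / ((n : ℝ) + 2)

lemma legendre_rec (n : ℕ) (t : ℝ) :
    ((n : ℝ) + 2) * legendre (n + 2) t =
      (2 * (n : ℝ) + 3) * t * legendre (n + 1) t - ((n : ℝ) + 1) * legendre n t := by
  have h : (n : ℝ) + 2 ≠ 0 := by positivity
  rw [legendre]
  field_simp

lemma legendre_energy (n : ℕ) (t : ℝ) :
    (1 - t ^ 2) * legendre n t ^ 2 + (legendre (n + 1) t - t * legendre n t) ^ 2 ≤ 1 - t ^ 2 := by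
  induction n with
  | zero => simp [legendre]
  | succ n ih =>
    have hr := legendre_rec n t
    set x := legendre (n + 2) t
    set y := legendre (n + 1) t
    set z := legendre n t
    have h2 : (0 : ℝ) < n + 2 := by positivity
    have hx : x - t * y = ((n + 1 : ℝ) / (n + 2)) * (t * y - z) := by
      field_simp
      linear_combination hr
    have hc : ((n + 1 : ℝ) / (n + 2)) ^ 2 ≤ 1 := by
      apply pow_le_one₀ (by positivity)
      rw [div_le_one h2]; linarith
    have h3 : (x - t * y) ^ 2 ≤ (t * y - z) ^ 2 := by
      rw [hx, mul_pow]
      exact mul_le_of_le_one_left (sq_nonneg _) hc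
    change (1 - t ^ 2) * y ^ 2 + (x - t * y) ^ 2 ≤ 1 - t ^ 2
    nlinarith

lemma legendre_endpoint (t : ℝ) (ht : t ^ 2 = 1) (n : ℕ) :
    legendre n t = t ^ n ∧ legendre (n + 1) t = t ^ (n + 1) := by
  induction n with
  | zero => simp [legendre]
  | succ n ih =>
    refine ⟨ih.2, ?_⟩
    have hr := legendre_rec n t
    rw [ih.1, ih.2] at hr
    have h2 : (n : ℝ) + 2 ≠ 0 := by positivity
    apply mul_left_cancel₀ h2
    rw [show n + 1 + 1 = n + 2 from rfl, hr]
    linear_combination (n + 1) * t ^ n * ht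

lemma legendre_abs_le (n : ℕ) (t : ℝ) (ht : t ∈ Set.Icc (-1 : ℝ) 1) : |legendre n t| ≤ 1 := by
  have h1 : t ^ 2 ≤ 1 := by nlinarith [ht.1, ht.2]
  rcases h1.eq_or_lt with h | h
  · rw [(legendre_endpoint t h n).1, abs_pow]
    exact pow_le_one₀ (abs_nonneg _) (abs_le.2 ht)
  · have he := legendre_energy n t
    have h2 : (1 - t ^ 2) * legendre n t ^ 2 ≤ (1 - t ^ 2) * 1 := by
      nlinarith [sq_nonneg (legendre (n + 1) t - t * legendre n t)]
    have := le_of_mul_le_mul_left h2 (by linarith)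
    exact (sq_le_one_iff_abs_le_one _).1 this

lemma legendre_summable (r t : ℝ) (hr : |r| < 1) (ht : t ∈ Set.Icc (-1 : ℝ) 1) :
    Summable fun k : ℕ => |r ^ k * legendre k t| := by
  refine Summable.of_nonneg_of_le (fun _ => abs_nonneg _) (fun k => ?_)
    (summable_geometric_of_lt_one (abs_nonneg r) hr)
  rw [abs_mul, abs_pow]
  exact mul_le_of_le_one_right (by positivity) (legendre_abs_le k t ht)

lemma geom_deriv_summable (ρ : ℝ) (h : |ρ| < 1) :
    Summable fun n : ℕ => ((n : ℝ) + 1) * ρ ^ n := by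
  have h1 := summable_pow_mul_geometric_of_norm_lt_one (R := ℝ) 1 (r := ρ) h
  have h2 := summable_geometric_of_norm_lt_one (K := ℝ) (x := ρ) h
  refine (h1.add h2).congr fun n => ?_
  simp; ring

lemma legendre_deriv_summable (r t : ℝ) (hr : |r| < 1) (ht : t ∈ Set.Icc (-1 : ℝ) 1) :
    Summable fun n : ℕ => ((n : ℝ) + 1) * r ^ n * legendre (n + 1) t := by
  refine Summable.of_norm_bounded (geom_deriv_summable |r| (by rwa [abs_abs])) fun n => ?_
  rw [Real.norm_eq_abs, abs_mul, abs_mul, abs_pow, abs_of_nonneg (by positivity : (0 : ℝ) ≤ n + 1)]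
  exact mul_le_of_le_one_right (by positivity) (legendre_abs_le _ t ht)

lemma legendre_hasDerivAt (r t : ℝ) (hr : |r| < 1) (ht : t ∈ Set.Icc (-1 : ℝ) 1) :
    HasDerivAt (fun x => ∑' k : ℕ, x ^ k * legendre k t)
      (∑' n : ℕ, ((n : ℝ) + 1) * r ^ n * legendre (n + 1) t) r := by
  obtain ⟨ρ, h1, h2⟩ := exists_between hr
  have hρ : 0 < ρ := (abs_nonneg r).trans_lt h1
  have hs : Summable fun n : ℕ => (n : ℝ) * ρ ^ (n - 1) := by
    rw [← summable_nat_add_iff 1]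
    simpa using geom_deriv_summable ρ (by rwa [abs_of_pos hρ])
  have key := hasDerivAt_tsum_of_isPreconnected (𝕜 := ℝ) (F := ℝ)
    (g := fun k x => x ^ k * legendre k t)
    (g' := fun k x => (k : ℝ) * x ^ (k - 1) * legendre k t)
    (t := Metric.ball (0 : ℝ) ρ) (y₀ := 0) (y := r) hs Metric.isOpen_ball
    (convex_ball (0 : ℝ) ρ).isPreconnected
    (fun n y _ => (hasDerivAt_pow n y).mul_const _)
    (fun n y hy => by
      rw [mem_ball_zero_iff, Real.norm_eq_abs] at hy
      rw [Real.norm_eq_abs, abs_mul, abs_mul, abs_pow, Nat.abs_cast]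
      refine (mul_le_of_le_one_right (by positivity) (legendre_abs_le _ t ht)).trans ?_
      gcongr)
    (by simpa using hρ) (legendre_summable 0 t (by simp) ht).of_abs (by simpa using h1)
  convert! key using 1
  have hsum : Summable fun k : ℕ => (k : ℝ) * r ^ (k - 1) * legendre k t := by
    rw [← summable_nat_add_iff 1]
    simpa using legendre_deriv_summable r t hr ht
  rw [hsum.tsum_eq_zero_add]
  simp

lemma legendre_ode (r t : ℝ) (hr : |r| < 1) (ht : t ∈ Set.Icc (-1 : ℝ) 1) :
    (1 - 2 * r * t + r ^ 2) * (∑' n : ℕ, ((n : ℝ) + 1) * r ^ n * legendre (n + 1) t) =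
      (t - r) * ∑' k : ℕ, r ^ k * legendre k t := by
  have hf := (legendre_summable r t hr ht).of_abs.hasSum
  have hG := (legendre_deriv_summable r t hr ht).hasSum
  set f := ∑' k : ℕ, r ^ k * legendre k t
  set G := ∑' n : ℕ, ((n : ℝ) + 1) * r ^ n * legendre (n + 1) t
  -- shifts
  have hf1 := (hasSum_nat_add_iff' 1).2 hf
  have hG1 := (hasSum_nat_add_iff' 1).2 hG
  have hn : HasSum (fun n : ℕ => (n : ℝ) * r ^ n * legendre n t) (r * G) := by
    rw [← hasSum_nat_add_iff' 1]
    simp only [Finset.sum_range_one, Nat.cast_zero, zero_mul, sub_zero]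
    convert! hG.mul_left r using 1
    ext n
    push_cast
    ring
  have hA := ((hG.mul_left (2 * t * r)).add (hf1.mul_left t)).sub ((hn.add hf).mul_left r)
  have heq := hG1.unique (a₂ := 2 * t * r * G + t * (f - 1) - r * (r * G + f)) (by
    convert! hA using 1
    · ext n
      have h := legendre_rec n t
      push_cast
      rw [show n + 1 + 1 = n + 2 from rfl]
      linear_combination r ^ (n + 1) * h
    · simp [legendre])
  simp [legendre] at heq
  linear_combination heq

lemma legendre_q_pos (r t : ℝ) (hr : |r| < 1) (ht : t ∈ Set.Icc (-1 : ℝ) 1) :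
    0 < 1 - 2 * r * t + r ^ 2 := by
  obtain ⟨h1, h2⟩ := abs_lt.1 hr
  rcases le_total 0 r with h | h
  · have := mul_nonneg h (sub_nonneg.2 ht.2)
    have : 0 < (1 - r) ^ 2 := by apply pow_pos; linarith
    nlinarith
  · have := mul_nonneg (neg_nonneg.2 h) (by linarith [ht.1] : 0 ≤ 1 + t)
    have : 0 < (1 + r) ^ 2 := by apply pow_pos; linarith
    nlinarith

theorem legendre_generating_function (r t : ℝ) (hr : |r| < 1) (ht : t ∈ Set.Icc (-1 : ℝ) 1) :
    (Summable fun k : ℕ => |r ^ k * legendre k t|) ∧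
    ∑' k : ℕ, r ^ k * legendre k t = (1 - 2 * r * t + r ^ 2) ^ (-(1 / 2) : ℝ) := by
  refine ⟨legendre_summable r t hr ht, ?_⟩
  have hd : ∀ x ∈ Metric.ball (0 : ℝ) 1, HasDerivAt
      (fun x : ℝ => (∑' k : ℕ, x ^ k * legendre k t) * √(1 - 2 * x * t + x ^ 2)) 0 x := by
    intro x hx
    rw [mem_ball_zero_iff, Real.norm_eq_abs] at hx
    have hq := legendre_q_pos x t hx ht
    have hq1 : HasDerivAt (fun x : ℝ => 1 - 2 * x * t + x ^ 2) (-(2 * t) + 2 * x) x := by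
      have h1 := ((((hasDerivAt_id x).const_mul 2).mul_const t).const_sub 1).add
        (hasDerivAt_pow 2 x)
      convert! h1 using 1
      simp
    have h := (legendre_hasDerivAt x t hx ht).mul (hq1.sqrt hq.ne')
    convert! h using 1
    have ho := legendre_ode x t hx ht
    have hs := Real.sq_sqrt hq.le
    have hs0 := (Real.sqrt_pos.2 hq).ne'
    field_simp
    rw [hs]
    linear_combination -ho
  have hc := Metric.isOpen_ball.is_const_of_deriv_eq_zero
    (convex_ball (0 : ℝ) 1).isPreconnected
    (fun x hx => (hd x hx).differentiableAt.differentiableWithinAt)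
    (fun x hx => (hd x hx).deriv) (x := r) (y := 0) (by simpa using hr) (by simp)
  have h0 : ∑' k : ℕ, (0 : ℝ) ^ k * legendre k t = 1 := by
    rw [tsum_eq_single 0 (fun k hk => by simp [hk])]
    simp [legendre]
  have hq := legendre_q_pos r t hr ht
  simp only [h0] at hc
  rw [Real.rpow_neg hq.le, ← Real.sqrt_eq_rpow]
  apply eq_inv_of_mul_eq_one_left
  rw [hc]
  simp
end

section
/- Fix x, y_c ∈ ℝ³ with x ≠ y_c, and for a multi-index 𝐤 = (k₁,k₂,k₃) ∈ ℕ³ define the Cartesian Taylor coefficient a^𝐤 = (1/(k₁!·k₂!·k₃!)) · ∂^{k₁}_{y₁}∂^{k₂}_{y₂}∂^{k₃}_{y₃} (1/‖x − y‖) evaluated at y = y_c, with the convention a^𝐦 = 0 whenever 𝐦 has a negative component. Then for every multi-index 𝐤 with ‖𝐤‖ = k₁+k₂+k₃ ≥ 1, the recurrence ‖𝐤‖·‖x − y_c‖²·a^𝐤 − (2‖𝐤‖ − 1)·Σ_{i=1}^{3} (x_i − (y_c)_i)·a^{𝐤 − e_i} + (‖𝐤‖ − 1)·Σ_{i=1}^{3}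 a^{𝐤 − 2e_i} = 0 holds, where e_i are the standard basis multi-indices. -/
open scoped BigOperators

/-- The partial-derivative operator in coordinate direction `i` on functions `ℝ³ → ℝ`. -/
noncomputable def pd (i : Fin 3) (f : EuclideanSpace ℝ (Fin 3) → ℝ) :
    EuclideanSpace ℝ (Fin 3) → ℝ :=
  fun y => fderiv ℝ f y (EuclideanSpace.single i (1 : ℝ))

/-- The mixed partial derivative `∂₁^{k₁} ∂₂^{k₂} ∂₃^{k₃} f`. -/
noncomputable def mixedPartial (k : Fin 3 → ℕ) (f : EuclideanSpace ℝ (Fin 3) → ℝ) :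
    EuclideanSpace ℝ (Fin 3) → ℝ :=
  (pd 0)^[k 0] ((pd 1)^[k 1] ((pd 2)^[k 2] f))

/-- The Cartesian Taylor (multipole) coefficient
`a^𝐤 = (1/𝐤!) · ∂^{k₁}_{y₁}∂^{k₂}_{y₂}∂^{k₃}_{y₃} (1/‖x − y‖) |_{y = y_c}`,
indexed by integer multi-indices with the convention that it vanishes whenever
some component is negative. -/
noncomputable def acoef (x yc : EuclideanSpace ℝ (Fin 3)) (m : Fin 3 → ℤ) : ℝ :=
  if ∀ i, 0 ≤ m i then
    (1 / (((m 0).toNat.factorial * (m 1).toNat.factorial * (m 2).toNat.factorial : ℕ) : ℝ)) *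
      mixedPartial (fun i => (m i).toNat) (fun y => ‖x - y‖⁻¹) yc
  else 0

section helpers
open scoped ContDiff

abbrev E3 := EuclideanSpace ℝ (Fin 3)

/-- Functions smooth away from `x`, vanishing at `x`. -/
def SM (x : E3) : Submodule ℝ (E3 → ℝ) where
  carrier := {f | ContDiffOn ℝ ∞ f {x}ᶜ ∧ f x = 0}
  add_mem' := by
    rintro f g ⟨hf, hf0⟩ ⟨hg, hg0⟩
    exact ⟨hf.add hg, by simp [hf0, hg0]⟩
  zero_mem' := ⟨contDiffOn_const, rfl⟩
  smul_mem' := by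
    rintro c f ⟨hf, hf0⟩
    exact ⟨hf.const_smul c, by simp [hf0]⟩

noncomputable instance SM.acm (x : E3) : AddCommMonoid (SM x) := (SM x).addCommGroup.toAddCommMonoid

noncomputable instance SM.mod (x : E3) : Module ℝ (SM x) := (SM x).module

lemma SM.cd {x : E3} (f : SM x) {y : E3} (hy : y ≠ x) : ContDiffAt ℝ ∞ (f : E3 → ℝ) y :=
  f.2.1.contDiffAt (isOpen_compl_singleton.mem_nhds hy)

lemma SM.diff {x : E3} (f : SM x) {y : E3} (hy : y ≠ x) : DifferentiableAt ℝ (f : E3 → ℝ) y :=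
  (SM.cd f hy).differentiableAt (by simp)

lemma SM.ext' {x : E3} {f g : SM x} (h : ∀ y, y ≠ x → (f : E3 → ℝ) y = (g : E3 → ℝ) y) :
    f = g := by
  apply Subtype.ext
  funext y
  by_cases hy : y = x
  · rw [hy, f.2.2, g.2.2]
  · exact h y hy

lemma pd_congr {x : E3} {f g : E3 → ℝ} (i : Fin 3) (h : ∀ y, y ≠ x → f y = g y) (y : E3)
    (hy : y ≠ x) : pd i f y = pd i g y := by
  have : f =ᶠ[nhds y] g := by
    filter_upwards [isOpen_compl_singleton.mem_nhds (show y ∈ ({x}ᶜ : Set E3) from hy)] with z hz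
    exact h z hz
  simp only [pd, this.fderiv_eq]

open Classical in
/-- The partial derivative as an endomorphism. -/
noncomputable def dd (x : E3) (i : Fin 3) : Module.End ℝ (SM x) where
  toFun f := ⟨fun y => if y = x then 0 else pd i f y, by
    constructor
    · have h : ContDiffOn ℝ ∞ (pd i f) {x}ᶜ := by
        have := (f.2.1.fderiv_of_isOpen isOpen_compl_singleton (m := ∞) (by simp))
        exact this.clm_apply contDiffOn_const
      refine h.congr ?_
      intro y hy
      exact if_neg hy
    · simp⟩
  map_add' f g := by
    apply SM.ext'
    intro y hy
    simp only [pd, if_neg hy, Submodule.coe_add, Pi.add_apply]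
    rw [fderiv_add (SM.diff f hy) (SM.diff g hy)]
    rfl
  map_smul' c f := by
    apply SM.ext'
    intro y hy
    simp only [pd, if_neg hy, Submodule.coe_smul, Pi.smul_apply, RingHom.id_apply]
    rw [fderiv_const_smul (SM.diff f hy)]
    rfl

lemma dd_apply {x : E3} (i : Fin 3) (f : SM x) {y : E3} (hy : y ≠ x) :
    (dd x i f : E3 → ℝ) y = pd i f y := by
  simp [dd, hy]

/-- Multiplication by `x_j - y_j`. -/
noncomputable def XX (x : E3) (j : Fin 3) : Module.End ℝ (SM x) where
  toFun f := ⟨fun y => (x j - y j) * (f : E3 → ℝ) y, by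
    constructor
    · have : ContDiffOn ℝ ∞ (fun y : E3 => x j - y j) {x}ᶜ := by fun_prop
      exact this.mul f.2.1
    · simp⟩
  map_add' f g := by
    apply SM.ext'
    intro y hy
    simp [mul_add]
  map_smul' c f := by
    apply SM.ext'
    intro y hy
    simp; ring

lemma XX_apply {x : E3} (i : Fin 3) (f : SM x) (y : E3) :
    (XX x i f : E3 → ℝ) y = (x i - y i) * (f : E3 → ℝ) y := rfl

lemma dd_comm (x : E3) (i j : Fin 3) : Commute (dd x i) (dd x j) := by
  apply LinearMap.ext
  intro f
  apply SM.ext'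
  intro y hy
  simp only [Module.End.mul_apply]
  rw [dd_apply _ _ hy, dd_apply _ _ hy]
  rw [pd_congr i (fun z hz => dd_apply j f hz) y hy, pd_congr j (fun z hz => dd_apply i f hz) y hy]
  have hs : IsSymmSndFDerivAt ℝ (f : E3 → ℝ) y := (SM.cd f hy).isSymmSndFDerivAt (by simp; exact WithTop.coe_le_coe.mpr le_top)
  have hd : DifferentiableAt ℝ (fderiv ℝ (f : E3 → ℝ)) y :=
    ((SM.cd f hy).fderiv_right (m := 1) (by norm_cast)).differentiableAt (by simp)
  have key : ∀ v w : E3, fderiv ℝ (fun z => fderiv ℝ (f : E3 → ℝ) z v) y w =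
      fderiv ℝ (fderiv ℝ (f : E3 → ℝ)) y w v := by
    intro v w
    rw [fderiv_clm_apply hd (by fun_prop)]
    simp
  simp only [pd]
  erw [key, key]
  exact hs.eq _ _

lemma dd_XX (x : E3) (i j : Fin 3) :
    dd x i * XX x j = XX x j * dd x i - if i = j then 1 else 0 := by
  apply LinearMap.ext
  intro f
  apply SM.ext'
  intro y hy
  have h1 : (dd x i (XX x j f) : E3 → ℝ) y =
      (x j - y j) * pd i f y - (if i = j then 1 else 0) * (f : E3 → ℝ) y := by
    rw [dd_apply _ _ hy]
    simp only [pd]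
    have h2 : HasFDerivAt (fun y : E3 => x j - y j) (-(EuclideanSpace.proj j : E3 →L[ℝ] ℝ)) y :=
      ((EuclideanSpace.proj j : E3 →L[ℝ] ℝ).hasFDerivAt (x := y)).const_sub (x j)
    have h3 := h2.mul (SM.diff f hy).hasFDerivAt
    have h4 : ((XX x j f : SM x) : E3 → ℝ) = (fun y : E3 => x j - y j) * (f : E3 → ℝ) := rfl
    rw [h4, h3.fderiv]
    by_cases hij : i = j
    · subst hij; simp; ring
    · simp [hij, Ne.symm hij]
  have h5 : ((XX x j (dd x i f) : SM x) : E3 → ℝ) y = (x j - y j) * pd i f y := by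
    rw [XX_apply, dd_apply _ _ hy]
  simp only [Module.End.mul_apply, LinearMap.sub_apply, Submodule.coe_sub, Pi.sub_apply]
  rw [h1, h5]
  split_ifs <;> simp

/-- The kernel. -/
noncomputable def ker3 (x : E3) : SM x := ⟨fun y => ‖x - y‖⁻¹, by
  constructor
  · intro y hy
    have : x - y ≠ 0 := sub_ne_zero.mpr (Ne.symm hy)
    have h : ContDiffAt ℝ ∞ (fun y : E3 => x - y) y := by fun_prop
    exact ((h.norm ℝ this).inv (by simpa using this)).contDiffWithinAt
  · simp⟩

lemma ker3_rel (x : E3) (i : Fin 3) :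
    (XX x 0 ^ 2 + XX x 1 ^ 2 + XX x 2 ^ 2) (dd x i (ker3 x)) = XX x i (ker3 x) := by
  apply SM.ext'
  intro y hy
  have hn : x - y ≠ 0 := sub_ne_zero.mpr (Ne.symm hy)
  have hn' : ‖x - y‖ ≠ 0 := by simpa using hn
  have hsq : ‖x - y‖ ^ 2 = (x 0 - y 0) ^ 2 + (x 1 - y 1) ^ 2 + (x 2 - y 2) ^ 2 := by
    rw [EuclideanSpace.real_norm_sq_eq, Fin.sum_univ_three]; rfl
  have hd : pd i (ker3 x) y = (x i - y i) / ‖x - y‖ ^ 3 := by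
    have hdiff := SM.diff (ker3 x) hy
    have h1 : HasFDerivAt (fun y : E3 => x - y) (-(ContinuousLinearMap.id ℝ E3)) y :=
      (hasFDerivAt_id y).const_sub x
    have h2 := h1.norm_sq
    have h3 := (hdiff.hasFDerivAt.mul hdiff.hasFDerivAt).mul h2
    have h4 : ((ker3 x : E3 → ℝ) * (ker3 x : E3 → ℝ) * fun y => ‖x - y‖ ^ 2)
        =ᶠ[nhds y] fun _ => (1 : ℝ) := by
      filter_upwards [isOpen_compl_singleton.mem_nhds (show y ∈ ({x}ᶜ : Set E3) from hy)] with z hz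
      have : ‖x - z‖ ≠ 0 := by simpa using sub_ne_zero.mpr (Ne.symm hz)
      simp only [Pi.mul_apply, ker3]
      field_simp
    have h5 := (h4.hasFDerivAt_iff.mp h3).unique (hasFDerivAt_const _ _)
    have h6 := congrArg (fun L => L (EuclideanSpace.single i (1 : ℝ))) h5
    simp [ker3] at h6
    change fderiv ℝ (fun y : E3 => ‖x - y‖⁻¹) y (EuclideanSpace.single i (1 : ℝ)) = _
    have h7 : ∀ z : E3, inner ℝ z (EuclideanSpace.single i (1 : ℝ)) = z i := by
      intro z
      simp [EuclideanSpace.inner_single_right]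
    rw [h7, h7] at h6
    field_simp at h6 ⊢
    linarith
  simp only [pow_two, LinearMap.add_apply, Module.End.mul_apply, Submodule.coe_add, Pi.add_apply,
    XX_apply, dd_apply _ _ hy, hd]
  have hk : (ker3 x : E3 → ℝ) y = ‖x - y‖⁻¹ := rfl
  rw [hk]
  field_simp
  rw [hsq]

lemma iter_eq {x : E3} (i : Fin 3) (n : ℕ) {f : E3 → ℝ} {F : SM x}
    (h : ∀ y, y ≠ x → f y = (F : E3 → ℝ) y) :
    ∀ y, y ≠ x → (pd i)^[n] f y = ((dd x i ^ n) F : E3 → ℝ) y := by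
  induction n with
  | zero => simpa using h
  | succ n ih =>
    intro y hy
    rw [Function.iterate_succ_apply', pow_succ', Module.End.mul_apply, dd_apply _ _ hy]
    exact pd_congr i ih y hy

noncomputable def DD (x : E3) (a b c : ℕ) : Module.End ℝ (SM x) :=
  dd x 0 ^ a * dd x 1 ^ b * dd x 2 ^ c

lemma mixed_eq {x : E3} (k : Fin 3 → ℕ) (y : E3) (hy : y ≠ x) :
    mixedPartial k (fun y => ‖x - y‖⁻¹) y = (DD x (k 0) (k 1) (k 2) (ker3 x) : E3 → ℝ) y := by
  unfold mixedPartial DD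
  have h := iter_eq 0 (k 0) (iter_eq 1 (k 1) (iter_eq 2 (k 2) (F := ker3 x)
    (f := fun y => ‖x - y‖⁻¹) (fun _ _ => rfl))) y hy
  exact h

lemma pow_X {A : Type*} [Ring A] {d X : A} (h : d * X = X * d - 1) (n : ℕ) :
    d ^ n * X = X * d ^ n - n * d ^ (n - 1) := by
  induction n with
  | zero => simp
  | succ n ih =>
    rw [pow_succ', mul_assoc, ih, mul_sub, ← mul_assoc, h]
    cases n with
    | zero => simp
    | succ m =>
      simp only [Nat.add_sub_cancel]
      rw [← mul_assoc, ← Nat.cast_comm, mul_assoc _ d, ← pow_succ']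
      push_cast
      noncomm_ring

lemma dd_XX_comm (x : E3) {i j : Fin 3} (h : i ≠ j) : Commute (dd x i) (XX x j) := by
  have := dd_XX x i j
  rw [if_neg h, sub_zero] at this
  exact this

lemma dd_XX_self (x : E3) (i : Fin 3) : dd x i * XX x i = XX x i * dd x i - 1 := by
  simpa using dd_XX x i i

lemma cast_pred (n : ℕ) : (n : ℝ) * ((n - 1 : ℕ) : ℝ) = n * (n - 1) := by
  cases n <;> simp

lemma DD_X0 (x : E3) (a b c : ℕ) :
    DD x a b c * XX x 0 = XX x 0 * DD x a b c - a * DD x (a - 1) b c := by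
  have h := pow_X (dd_XX_self x 0) a
  have c1 : Commute (dd x 1 ^ b) (XX x 0) := ((dd_XX_comm x (by decide : (1 : Fin 3) ≠ 0)).pow_left _)
  have c2 : Commute (dd x 2 ^ c) (XX x 0) := ((dd_XX_comm x (by decide : (2 : Fin 3) ≠ 0)).pow_left _)
  unfold DD
  rw [mul_assoc, c2.eq, ← mul_assoc, mul_assoc (dd x 0 ^ a), c1.eq, ← mul_assoc, h]
  noncomm_ring

lemma DD_sq0 (x : E3) (a b c : ℕ) :
    DD x a b c * XX x 0 ^ 2 = XX x 0 ^ 2 * DD x a b c - (2 * a : ℕ) * (XX x 0 * DD x (a - 1) b c)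
      + (a * (a - 1) : ℕ) * DD x (a - 2) b c := by
  rw [pow_two, ← mul_assoc, DD_X0, sub_mul, mul_assoc, DD_X0, mul_assoc, DD_X0, Nat.sub_sub]
  push_cast
  have : XX x 0 * ((a : Module.End ℝ (SM x)) * DD x (a - 1) b c) = a * (XX x 0 * DD x (a - 1) b c) := by
    rw [← mul_assoc, ← Nat.cast_comm, mul_assoc]
  rw [mul_sub, mul_sub, this]
  noncomm_ring

lemma DD_d0 (x : E3) (a b c : ℕ) :
    DD x a b c * dd x 0 = DD x (a + 1) b c := by
  have c1 := (dd_comm x 1 0).pow_left b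
  have c2 := (dd_comm x 2 0).pow_left c
  unfold DD
  rw [mul_assoc, c2.eq, ← mul_assoc, mul_assoc (dd x 0 ^ a), c1.eq, ← mul_assoc, pow_succ]

lemma DD_X1 (x : E3) (a b c : ℕ) :
    DD x a b c * XX x 1 = XX x 1 * DD x a b c - b * DD x a (b - 1) c := by
  have h := pow_X (dd_XX_self x 1) b
  have c0 : Commute (dd x 0 ^ a) (XX x 1) := ((dd_XX_comm x (by decide : (0 : Fin 3) ≠ 1)).pow_left _)
  have c2 : Commute (dd x 2 ^ c) (XX x 1) := ((dd_XX_comm x (by decide : (2 : Fin 3) ≠ 1)).pow_left _)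
  unfold DD
  rw [mul_assoc, c2.eq, ← mul_assoc, mul_assoc (dd x 0 ^ a), h, mul_sub, ← mul_assoc, c0.eq,
    ← mul_assoc, ← Nat.cast_comm b (dd x 0 ^ a)]
  noncomm_ring

lemma DD_sq1 (x : E3) (a b c : ℕ) :
    DD x a b c * XX x 1 ^ 2 = XX x 1 ^ 2 * DD x a b c - (2 * b : ℕ) * (XX x 1 * DD x a (b - 1) c)
      + (b * (b - 1) : ℕ) * DD x a (b - 2) c := by
  rw [pow_two, ← mul_assoc, DD_X1, sub_mul, mul_assoc, DD_X1, mul_assoc, DD_X1, Nat.sub_sub]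
  push_cast
  have : XX x 1 * ((b : Module.End ℝ (SM x)) * DD x a (b - 1) c) = b * (XX x 1 * DD x a (b - 1) c) := by
    rw [← mul_assoc, ← Nat.cast_comm, mul_assoc]
  rw [mul_sub, mul_sub, this]
  noncomm_ring

lemma DD_d1 (x : E3) (a b c : ℕ) :
    DD x a b c * dd x 1 = DD x a (b + 1) c := by
  have c1 := (dd_comm x 1 1).pow_left b
  have c2 := (dd_comm x 2 1).pow_left c
  unfold DD
  rw [mul_assoc, c2.eq, ← mul_assoc, mul_assoc (dd x 0 ^ a), pow_succ]

lemma DD_X2 (x : E3) (a b c : ℕ) :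
    DD x a b c * XX x 2 = XX x 2 * DD x a b c - c * DD x a b (c - 1) := by
  have h := pow_X (dd_XX_self x 2) c
  have c0 : Commute (dd x 0 ^ a) (XX x 2) := ((dd_XX_comm x (by decide : (0 : Fin 3) ≠ 2)).pow_left _)
  have c1 : Commute (dd x 1 ^ b) (XX x 2) := ((dd_XX_comm x (by decide : (1 : Fin 3) ≠ 2)).pow_left _)
  unfold DD
  rw [mul_assoc, h, mul_sub, ← mul_assoc, mul_assoc (dd x 0 ^ a), c1.eq, ← mul_assoc, c0.eq,
    ← mul_assoc, ← Nat.cast_comm c (dd x 0 ^ a * dd x 1 ^ b)]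
  noncomm_ring

lemma DD_sq2 (x : E3) (a b c : ℕ) :
    DD x a b c * XX x 2 ^ 2 = XX x 2 ^ 2 * DD x a b c - (2 * c : ℕ) * (XX x 2 * DD x a b (c - 1))
      + (c * (c - 1) : ℕ) * DD x a b (c - 2) := by
  rw [pow_two, ← mul_assoc, DD_X2, sub_mul, mul_assoc, DD_X2, mul_assoc, DD_X2, Nat.sub_sub]
  push_cast
  have : XX x 2 * ((c : Module.End ℝ (SM x)) * DD x a b (c - 1)) = c * (XX x 2 * DD x a b (c - 1)) := by
    rw [← mul_assoc, ← Nat.cast_comm, mul_assoc]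
  rw [mul_sub, mul_sub, this]
  noncomm_ring

lemma DD_d2 (x : E3) (a b c : ℕ) :
    DD x a b c * dd x 2 = DD x a b (c + 1) := by
  have c1 := (dd_comm x 1 2).pow_left b
  have c2 := (dd_comm x 2 2).pow_left c
  unfold DD
  rw [mul_assoc, pow_succ]

/-- The mixed derivatives of the kernel. -/
noncomputable def TT (x y : E3) (a b c : ℕ) : ℝ := (DD x a b c (ker3 x) : E3 → ℝ) y

lemma coe_natmul {x : E3} (n : ℕ) (F : Module.End ℝ (SM x)) (f : SM x) (y : E3) :
    (((n : Module.End ℝ (SM x)) * F) f : E3 → ℝ) y = n * (F f : E3 → ℝ) y := by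
  rw [← nsmul_eq_mul]
  simp

lemma coe_XX {x : E3} (j : Fin 3) (F : Module.End ℝ (SM x)) (f : SM x) (y : E3) :
    ((XX x j * F) f : E3 → ℝ) y = (x j - y j) * (F f : E3 → ℝ) y := rfl

lemma coe_XX2 {x : E3} (j : Fin 3) (F : Module.End ℝ (SM x)) (f : SM x) (y : E3) :
    ((XX x j ^ 2 * F) f : E3 → ℝ) y = (x j - y j) ^ 2 * (F f : E3 → ℝ) y := by
  rw [pow_two, pow_two, mul_assoc, mul_assoc]
  rfl

lemma rel0 (x y : E3) (a b c : ℕ) :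
    ((x 0 - y 0) ^ 2 + (x 1 - y 1) ^ 2 + (x 2 - y 2) ^ 2) * TT x y (a + 1) b c
      - (2 * a : ℕ) * ((x 0 - y 0) * TT x y ((a - 1) + 1) b c) + (a * (a - 1) : ℕ) * TT x y ((a - 2) + 1) b c
      - (2 * b : ℕ) * ((x 1 - y 1) * TT x y (a + 1) (b - 1) c) + (b * (b - 1) : ℕ) * TT x y (a + 1) (b - 2) c
      - (2 * c : ℕ) * ((x 2 - y 2) * TT x y (a + 1) b (c - 1)) + (c * (c - 1) : ℕ) * TT x y (a + 1) b (c - 2)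
      = (x 0 - y 0) * TT x y a b c - a * TT x y (a - 1) b c := by
  have h : (DD x a b c * (XX x 0 ^ 2 + XX x 1 ^ 2 + XX x 2 ^ 2) * dd x 0) (ker3 x)
      = (DD x a b c * XX x 0) (ker3 x) := by
    simp only [Module.End.mul_apply]
    rw [ker3_rel]
  have h2 := congrArg (fun f : SM x => (f : E3 → ℝ) y) h
  rw [mul_add, mul_add, DD_sq0, DD_sq1, DD_sq2, DD_X0] at h2
  simp only [add_mul, sub_mul, mul_assoc, DD_d0] at h2
  simp only [LinearMap.add_apply, LinearMap.sub_apply, Submodule.coe_add, Submodule.coe_sub,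
    Pi.add_apply, Pi.sub_apply, coe_natmul, coe_XX, coe_XX2] at h2
  simp only [TT]
  linear_combination h2

lemma nrel0 (x y : E3) (a b c : ℕ) :
    (a : ℝ) * (((x 0 - y 0) ^ 2 + (x 1 - y 1) ^ 2 + (x 2 - y 2) ^ 2) * TT x y a b c
      - 2 * (a - 1 : ℝ) * (x 0 - y 0) * TT x y (a - 1) b c + (a - 1 : ℝ) * (a - 2 : ℝ) * TT x y (a - 2) b c
      - 2 * (b : ℝ) * (x 1 - y 1) * TT x y a (b - 1) c + (b : ℝ) * (b - 1 : ℝ) * TT x y a (b - 2) c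
      - 2 * (c : ℝ) * (x 2 - y 2) * TT x y a b (c - 1) + (c : ℝ) * (c - 1 : ℝ) * TT x y a b (c - 2)
      - (x 0 - y 0) * TT x y (a - 1) b c + (a - 1 : ℝ) * TT x y (a - 2) b c) = 0 := by
  have hc := cast_pred
  rcases a with _ | a
  · simp
  have h := rel0 x y a b c
  refine mul_eq_zero_of_right _ ?_
  simp only [Nat.cast_mul, hc b, hc c] at h
  rcases a with _ | _ | a
  · norm_num at h ⊢
    linear_combination h
  · norm_num at h ⊢
    linear_combination h
  · have e1 : a + 1 + 1 + 1 - 2 = a + 1 := by omega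
    have e2 : a + 1 + 1 - 2 + 1 = a + 1 := by omega
    rw [e1]
    rw [e2] at h
    simp only [Nat.add_sub_cancel] at h ⊢
    push_cast at h ⊢
    linear_combination h

lemma rel1 (x y : E3) (a b c : ℕ) :
    ((x 0 - y 0) ^ 2 + (x 1 - y 1) ^ 2 + (x 2 - y 2) ^ 2) * TT x y a (b + 1) c
      - (2 * a : ℕ) * ((x 0 - y 0) * TT x y (a - 1) (b + 1) c) + (a * (a - 1) : ℕ) * TT x y (a - 2) (b + 1) c
      - (2 * b : ℕ) * ((x 1 - y 1) * TT x y a ((b - 1) + 1) c) + (b * (b - 1) : ℕ) * TT x y a ((b - 2) + 1) c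
      - (2 * c : ℕ) * ((x 2 - y 2) * TT x y a (b + 1) (c - 1)) + (c * (c - 1) : ℕ) * TT x y a (b + 1) (c - 2)
      = (x 1 - y 1) * TT x y a b c - b * TT x y a (b - 1) c := by
  have h : (DD x a b c * (XX x 0 ^ 2 + XX x 1 ^ 2 + XX x 2 ^ 2) * dd x 1) (ker3 x)
      = (DD x a b c * XX x 1) (ker3 x) := by
    simp only [Module.End.mul_apply]
    rw [ker3_rel]
  have h2 := congrArg (fun f : SM x => (f : E3 → ℝ) y) h
  rw [mul_add, mul_add, DD_sq0, DD_sq1, DD_sq2, DD_X1] at h2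
  simp only [add_mul, sub_mul, mul_assoc, DD_d1] at h2
  simp only [LinearMap.add_apply, LinearMap.sub_apply, Submodule.coe_add, Submodule.coe_sub,
    Pi.add_apply, Pi.sub_apply, coe_natmul, coe_XX, coe_XX2] at h2
  simp only [TT]
  linear_combination h2

lemma nrel1 (x y : E3) (a b c : ℕ) :
    (b : ℝ) * (((x 0 - y 0) ^ 2 + (x 1 - y 1) ^ 2 + (x 2 - y 2) ^ 2) * TT x y a b c
      - 2 * (a : ℝ) * (x 0 - y 0) * TT x y (a - 1) b c + (a : ℝ) * (a - 1 : ℝ) * TT x y (a - 2) b c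
      - 2 * (b - 1 : ℝ) * (x 1 - y 1) * TT x y a (b - 1) c + (b - 1 : ℝ) * (b - 2 : ℝ) * TT x y a (b - 2) c
      - 2 * (c : ℝ) * (x 2 - y 2) * TT x y a b (c - 1) + (c : ℝ) * (c - 1 : ℝ) * TT x y a b (c - 2)
      - (x 1 - y 1) * TT x y a (b - 1) c + (b - 1 : ℝ) * TT x y a (b - 2) c) = 0 := by
  have hc := cast_pred
  rcases b with _ | b
  · simp
  have h := rel1 x y a b c
  refine mul_eq_zero_of_right _ ?_
  simp only [Nat.cast_mul, hc a, hc c] at h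
  rcases b with _ | _ | b
  · norm_num at h ⊢
    linear_combination h
  · norm_num at h ⊢
    linear_combination h
  · have e1 : b + 1 + 1 + 1 - 2 = b + 1 := by omega
    have e2 : b + 1 + 1 - 2 + 1 = b + 1 := by omega
    rw [e1]
    rw [e2] at h
    simp only [Nat.add_sub_cancel] at h ⊢
    push_cast at h ⊢
    linear_combination h

lemma rel2 (x y : E3) (a b c : ℕ) :
    ((x 0 - y 0) ^ 2 + (x 1 - y 1) ^ 2 + (x 2 - y 2) ^ 2) * TT x y a b (c + 1)
      - (2 * a : ℕ) * ((x 0 - y 0) * TT x y (a - 1) b (c + 1)) + (a * (a - 1) : ℕ) * TT x y (a - 2) b (c + 1)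
      - (2 * b : ℕ) * ((x 1 - y 1) * TT x y a (b - 1) (c + 1)) + (b * (b - 1) : ℕ) * TT x y a (b - 2) (c + 1)
      - (2 * c : ℕ) * ((x 2 - y 2) * TT x y a b ((c - 1) + 1)) + (c * (c - 1) : ℕ) * TT x y a b ((c - 2) + 1)
      = (x 2 - y 2) * TT x y a b c - c * TT x y a b (c - 1) := by
  have h : (DD x a b c * (XX x 0 ^ 2 + XX x 1 ^ 2 + XX x 2 ^ 2) * dd x 2) (ker3 x)
      = (DD x a b c * XX x 2) (ker3 x) := by
    simp only [Module.End.mul_apply]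
    rw [ker3_rel]
  have h2 := congrArg (fun f : SM x => (f : E3 → ℝ) y) h
  rw [mul_add, mul_add, DD_sq0, DD_sq1, DD_sq2, DD_X2] at h2
  simp only [add_mul, sub_mul, mul_assoc, DD_d2] at h2
  simp only [LinearMap.add_apply, LinearMap.sub_apply, Submodule.coe_add, Submodule.coe_sub,
    Pi.add_apply, Pi.sub_apply, coe_natmul, coe_XX, coe_XX2] at h2
  simp only [TT]
  linear_combination h2

lemma nrel2 (x y : E3) (a b c : ℕ) :
    (c : ℝ) * (((x 0 - y 0) ^ 2 + (x 1 - y 1) ^ 2 + (x 2 - y 2) ^ 2) * TT x y a b c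
      - 2 * (a : ℝ) * (x 0 - y 0) * TT x y (a - 1) b c + (a : ℝ) * (a - 1 : ℝ) * TT x y (a - 2) b c
      - 2 * (b : ℝ) * (x 1 - y 1) * TT x y a (b - 1) c + (b : ℝ) * (b - 1 : ℝ) * TT x y a (b - 2) c
      - 2 * (c - 1 : ℝ) * (x 2 - y 2) * TT x y a b (c - 1) + (c - 1 : ℝ) * (c - 2 : ℝ) * TT x y a b (c - 2)
      - (x 2 - y 2) * TT x y a b (c - 1) + (c - 1 : ℝ) * TT x y a b (c - 2)) = 0 := by
  have hc := cast_pred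
  rcases c with _ | c
  · simp
  have h := rel2 x y a b c
  refine mul_eq_zero_of_right _ ?_
  simp only [Nat.cast_mul, hc a, hc b] at h
  rcases c with _ | _ | c
  · norm_num at h ⊢
    linear_combination h
  · norm_num at h ⊢
    linear_combination h
  · have e1 : c + 1 + 1 + 1 - 2 = c + 1 := by omega
    have e2 : c + 1 + 1 - 2 + 1 = c + 1 := by omega
    rw [e1]
    rw [e2] at h
    simp only [Nat.add_sub_cancel] at h ⊢
    push_cast at h ⊢
    linear_combination h


lemma acoef_nonneg {x y : E3} (hy : y ≠ x) (a b c : ℕ) (m : Fin 3 → ℤ)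
    (h0 : m 0 = a) (h1 : m 1 = b) (h2 : m 2 = c) :
    acoef x y m * (a.factorial * b.factorial * c.factorial) = TT x y a b c := by
  have h : ∀ i, 0 ≤ m i := by
    intro i
    fin_cases i <;> simp [h0, h1, h2]
  rw [acoef, if_pos h, mixed_eq _ _ hy]
  simp only [h0, h1, h2, Int.toNat_natCast, TT]
  have := Nat.cast_ne_zero (R := ℝ).mpr a.factorial_ne_zero
  have := Nat.cast_ne_zero (R := ℝ).mpr b.factorial_ne_zero
  have := Nat.cast_ne_zero (R := ℝ).mpr c.factorial_ne_zero
  push_cast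
  field_simp

lemma acoef_neg {x y : E3} (m : Fin 3 → ℤ) (i : Fin 3) (h : m i < 0) : acoef x y m = 0 := by
  rw [acoef, if_neg]
  intro h'
  exact absurd (h' i) (not_le.mpr h)

lemma acoef_one0 {x y : E3} (hy : y ≠ x) (a b c : ℕ) (m : Fin 3 → ℤ)
    (h0 : m 0 = a - 1) (h1 : m 1 = b) (h2 : m 2 = c) :
    acoef x y m * (a.factorial * b.factorial * c.factorial) = a * TT x y (a - 1) b c := by
  rcases a with _ | a
  · rw [acoef_neg m 0 (by rw [h0]; norm_num)]
    simp
  · have h := acoef_nonneg hy a b c m (by push_cast [h0]; ring) (by push_cast [h1]; ring)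
      (by push_cast [h2]; ring)
    rw [Nat.add_sub_cancel, ← h, Nat.factorial_succ]
    push_cast
    ring

lemma acoef_two0 {x y : E3} (hy : y ≠ x) (a b c : ℕ) (m : Fin 3 → ℤ)
    (h0 : m 0 = a - 2) (h1 : m 1 = b) (h2 : m 2 = c) :
    acoef x y m * (a.factorial * b.factorial * c.factorial)
      = a * (a - 1) * TT x y (a - 2) b c := by
  rcases a with _ | _ | a
  · rw [acoef_neg m 0 (by rw [h0]; norm_num)]
    simp
  · rw [acoef_neg m 0 (by rw [h0]; norm_num)]
    simp
  · have h := acoef_nonneg hy a b c m (by push_cast [h0]; ring) (by push_cast [h1]; ring)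
      (by push_cast [h2]; ring)
    have e : a + 1 + 1 - 2 = a := by omega
    rw [e, ← h, Nat.factorial_succ, Nat.factorial_succ]
    push_cast
    ring

lemma acoef_one1 {x y : E3} (hy : y ≠ x) (a b c : ℕ) (m : Fin 3 → ℤ)
    (h0 : m 0 = a) (h1 : m 1 = b - 1) (h2 : m 2 = c) :
    acoef x y m * (a.factorial * b.factorial * c.factorial) = b * TT x y a (b - 1) c := by
  rcases b with _ | b
  · rw [acoef_neg m 1 (by rw [h1]; norm_num)]
    simp
  · have h := acoef_nonneg hy a b c m (by push_cast [h0]; ring) (by push_cast [h1]; ring)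
      (by push_cast [h2]; ring)
    rw [Nat.add_sub_cancel, ← h, Nat.factorial_succ]
    push_cast
    ring

lemma acoef_two1 {x y : E3} (hy : y ≠ x) (a b c : ℕ) (m : Fin 3 → ℤ)
    (h0 : m 0 = a) (h1 : m 1 = b - 2) (h2 : m 2 = c) :
    acoef x y m * (a.factorial * b.factorial * c.factorial)
      = b * (b - 1) * TT x y a (b - 2) c := by
  rcases b with _ | _ | b
  · rw [acoef_neg m 1 (by rw [h1]; norm_num)]
    simp
  · rw [acoef_neg m 1 (by rw [h1]; norm_num)]
    simp
  · have h := acoef_nonneg hy a b c m (by push_cast [h0]; ring) (by push_cast [h1]; ring)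
      (by push_cast [h2]; ring)
    have e : b + 1 + 1 - 2 = b := by omega
    rw [e, ← h, Nat.factorial_succ, Nat.factorial_succ]
    push_cast
    ring

lemma acoef_one2 {x y : E3} (hy : y ≠ x) (a b c : ℕ) (m : Fin 3 → ℤ)
    (h0 : m 0 = a) (h1 : m 1 = b) (h2 : m 2 = c - 1) :
    acoef x y m * (a.factorial * b.factorial * c.factorial) = c * TT x y a b (c - 1) := by
  rcases c with _ | c
  · rw [acoef_neg m 2 (by rw [h2]; norm_num)]
    simp
  · have h := acoef_nonneg hy a b c m (by push_cast [h0]; ring) (by push_cast [h1]; ring)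
      (by push_cast [h2]; ring)
    rw [Nat.add_sub_cancel, ← h, Nat.factorial_succ]
    push_cast
    ring

lemma acoef_two2 {x y : E3} (hy : y ≠ x) (a b c : ℕ) (m : Fin 3 → ℤ)
    (h0 : m 0 = a) (h1 : m 1 = b) (h2 : m 2 = c - 2) :
    acoef x y m * (a.factorial * b.factorial * c.factorial)
      = c * (c - 1) * TT x y a b (c - 2) := by
  rcases c with _ | _ | c
  · rw [acoef_neg m 2 (by rw [h2]; norm_num)]
    simp
  · rw [acoef_neg m 2 (by rw [h2]; norm_num)]
    simp
  · have h := acoef_nonneg hy a b c m (by push_cast [h0]; ring) (by push_cast [h1]; ring)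
      (by push_cast [h2]; ring)
    have e : c + 1 + 1 - 2 = c := by omega
    rw [e, ← h, Nat.factorial_succ, Nat.factorial_succ]
    push_cast
    ring

end helpers

/-- The recurrence relation (Li–Johnston–Krasny) for the Cartesian multipole
expansion coefficients of the kernel `1/‖x − y‖`:
`‖𝐤‖·‖x − y_c‖²·a^𝐤 − (2‖𝐤‖−1)·Σᵢ (xᵢ − (y_c)ᵢ)·a^{𝐤−eᵢ} + (‖𝐤‖−1)·Σᵢ a^{𝐤−2eᵢ} = 0`. -/
theorem multipole_coefficient_recurrence
    (x yc : EuclideanSpace ℝ (Fin 3)) (hx : x ≠ yc)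
    (k : Fin 3 → ℕ) (hk : 1 ≤ k 0 + k 1 + k 2) :
    ((k 0 + k 1 + k 2 : ℕ) : ℝ) * ‖x - yc‖ ^ 2 * acoef x yc (fun i => (k i : ℤ))
      - (2 * ((k 0 + k 1 + k 2 : ℕ) : ℝ) - 1) *
          ∑ i : Fin 3, (x i - yc i) *
            acoef x yc (fun j => (k j : ℤ) - if j = i then 1 else 0)
      + (((k 0 + k 1 + k 2 : ℕ) : ℝ) - 1) *
          ∑ i : Fin 3, acoef x yc (fun j => (k j : ℤ) - if j = i then 2 else 0) = 0 := by
  have hy : yc ≠ x := Ne.symm hx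
  have hsq : ‖x - yc‖ ^ 2 = (x 0 - yc 0) ^ 2 + (x 1 - yc 1) ^ 2 + (x 2 - yc 2) ^ 2 := by
    rw [EuclideanSpace.real_norm_sq_eq, Fin.sum_univ_three]; rfl
  have A := acoef_nonneg hy (k 0) (k 1) (k 2) (fun i => (k i : ℤ)) rfl rfl rfl
  have one0 := acoef_one0 hy (k 0) (k 1) (k 2)
    (fun j => (k j : ℤ) - if j = 0 then 1 else 0) (by simp) (by simp) (by simp)
  have two0 := acoef_two0 hy (k 0) (k 1) (k 2)
    (fun j => (k j : ℤ) - if j = 0 then 2 else 0) (by simp) (by simp) (by simp)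
  have one1 := acoef_one1 hy (k 0) (k 1) (k 2)
    (fun j => (k j : ℤ) - if j = 1 then 1 else 0) (by simp) (by simp) (by simp)
  have two1 := acoef_two1 hy (k 0) (k 1) (k 2)
    (fun j => (k j : ℤ) - if j = 1 then 2 else 0) (by simp) (by simp) (by simp)
  have one2 := acoef_one2 hy (k 0) (k 1) (k 2)
    (fun j => (k j : ℤ) - if j = 2 then 1 else 0) (by simp) (by simp) (by simp)
  have two2 := acoef_two2 hy (k 0) (k 1) (k 2)
    (fun j => (k j : ℤ) - if j = 2 then 2 else 0) (by simp) (by simp) (by simp)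
  have n0 := nrel0 x yc (k 0) (k 1) (k 2)
  have n1 := nrel1 x yc (k 0) (k 1) (k 2)
  have n2 := nrel2 x yc (k 0) (k 1) (k 2)
  rw [Fin.sum_univ_three, Fin.sum_univ_three, hsq]
  have hF : ((k 0).factorial * (k 1).factorial * (k 2).factorial : ℝ) ≠ 0 := by positivity
  apply (mul_eq_zero.mp _).resolve_right hF
  push_cast
  generalize ((k 0).factorial * (k 1).factorial * (k 2).factorial : ℝ) = F at *
  generalize acoef x yc (fun i => (k i : ℤ)) = B at *
  linear_combination (k 0 + k 1 + k 2 : ℝ) * ((x 0 - yc 0) ^ 2 + (x 1 - yc 1) ^ 2 + (x 2 - yc 2) ^ 2) * A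
    - (2 * (k 0 + k 1 + k 2 : ℝ) - 1) * (x 0 - yc 0) * one0 + ((k 0 + k 1 + k 2 : ℝ) - 1) * two0
    - (2 * (k 0 + k 1 + k 2 : ℝ) - 1) * (x 1 - yc 1) * one1 + ((k 0 + k 1 + k 2 : ℝ) - 1) * two1
    - (2 * (k 0 + k 1 + k 2 : ℝ) - 1) * (x 2 - yc 2) * one2 + ((k 0 + k 1 + k 2 : ℝ) - 1) * two2
    + n0 + n1 + n2
end
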